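/- arXiv:2407.02963 — 5 statements merged into one kernel-verified Lean document; each statement's English description precedes it below -/
import Mathlib

section
/- Let q be a power of a prime, let F be a finite field with q² elements, let K be a subfield of F with q elements, and let g be a generator of the multiplicative group Fˣ. Define S = {i ∈ ℕ : 1 ≤ i ≤ q² − 2 and g^i − g ∈ K}. Then S has exactly q elements. -/
/-- **Bose–Chowla set cardinality.** Let `q` be a prime power, `F` a finite field with `q²`
elements, `K` a subfield of `F` with `q` elements, and `g` a generator of `Fˣ`. Then the
Bose–Chowla set `S = {i : 1 ≤ i ≤ q² − 2, gⁱ − g ∈ K}` has exactly `q` elements. -/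
theorem stmt_0 (q : ℕ) (hq : IsPrimePow q) (F : Type*) [Field F]
    (hF : Nat.card F = q ^ 2) (K : Subfield F) (hK : Nat.card K = q)
    (g : Fˣ) (hg : ∀ x : Fˣ, x ∈ Subgroup.zpowers g)
    (S : Set ℕ) (hS : S = {i : ℕ | 1 ≤ i ∧ i ≤ q ^ 2 - 2 ∧ (g : F) ^ i - (g : F) ∈ K}) :
    S.ncard = q := by
  have hq2 : 2 ≤ q := hq.two_le
  classical
  have hlt : q < q ^ 2 := by nlinarith
  have : Finite F := Nat.finite_of_card_ne_zero (by omega)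
  have hord : orderOf g = q ^ 2 - 1 := by
    rw [orderOf_eq_card_of_forall_mem_zpowers hg, Nat.card_units, hF]
  have hgK : (g : F) ∉ K := by
    intro h
    have htop : ∀ x : F, x ∈ K := by
      intro x
      rcases eq_or_ne x 0 with rfl | hx
      · exact K.zero_mem
      · obtain ⟨n, hn⟩ := hg (Units.mk0 x hx)
        have hxn : (g : F) ^ n = x := by
          simpa using congrArg (Units.val : Fˣ → F) hn
        exact hxn ▸ zpow_mem h n
    have hcard : Nat.card K = Nat.card F := Nat.card_congr (Equiv.subtypeUnivEquiv htop)
    omega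
  have hinj : Set.InjOn (fun i : ℕ => (g : F) ^ i - (g : F)) S := by
    intro i hi j hj hij
    rw [hS] at hi hj
    have hpow : g ^ i = g ^ j := by
      ext
      simpa using hij
    obtain ⟨_, hi, _⟩ := hi
    obtain ⟨_, hj, _⟩ := hj
    exact pow_injOn_Iio_orderOf (by rw [Set.mem_Iio, hord]; omega)
      (by rw [Set.mem_Iio, hord]; omega) hpow
  have himage : (fun i : ℕ => (g : F) ^ i - (g : F)) '' S = (K : Set F) := by
    ext k
    constructor
    · rintro ⟨i, hi, rfl⟩
      rw [hS] at hi
      exact hi.2.2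
    · intro hk
      have hne : (g : F) + k ≠ 0 := fun h =>
        hgK (eq_neg_of_add_eq_zero_left h ▸ K.neg_mem hk)
      obtain ⟨i, hi, hgi⟩ := Finset.mem_image.mp
        (mem_zpowers_iff_mem_range_orderOf.mp (hg (Units.mk0 _ hne)))
      rw [Finset.mem_range, hord] at hi
      have hval : (g : F) ^ i = g + k := by
        simpa using congrArg (Units.val : Fˣ → F) hgi
      have hi0 : i ≠ 0 := by
        rintro rfl
        rw [pow_zero] at hval
        exact hgK (eq_sub_of_add_eq hval.symm ▸ K.sub_mem K.one_mem hk)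
      have hik : (g : F) ^ i - g = k := by rw [hval, add_sub_cancel_left]
      refine ⟨i, ?_, hik⟩
      rw [hS]
      exact ⟨by omega, by omega, hik ▸ hk⟩
  rw [← hinj.ncard_image, himage]
  exact hK
end

section
/- Let q be a power of a prime, let F be a finite field with q² elements, let K be a subfield of F with q elements, and let g be a generator of the multiplicative group Fˣ. Define S = {i ∈ ℕ : 1 ≤ i ≤ q² − 2 and g^i − g ∈ K}. Then the pairwise differences of distinct elements of S are distinct modulo q² − 1: for all i, j, k, l ∈ S with i ≠ j and k ≠ l, if i − j ≡ k − l (mod q² − 1) then i = k and j = l. -/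
/-- A generator of the unit group of a field lies in no proper subfield. -/
theorem Subfield.eq_top_of_zpowers_generator_mem {F : Type*} [Field F] (K : Subfield F) (g : Fˣ)
    (hg : ∀ x : Fˣ, x ∈ Subgroup.zpowers g) (hgK : (g : F) ∈ K) : K = ⊤ := by
  refine eq_top_iff.2 fun x _ => ?_
  rcases eq_or_ne x 0 with rfl | hx
  · exact K.zero_mem
  · obtain ⟨n, hn⟩ := Subgroup.mem_zpowers_iff.1 (hg (Units.mk0 x hx))
    have hgx : (g : F) ^ n = x := by simpa using congrArg Units.val hn
    exact hgx ▸ zpow_mem hgK n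

/-- If `x ∉ K`, then a product of two elements of the coset `x + K` determines its factors
up to order. -/
theorem Subfield.eq_or_eq_of_mul_eq_mul_of_sub_mem {F : Type*} [Field F] (K : Subfield F)
    {x a b c d : F} (hx : x ∉ K) (ha : a - x ∈ K) (hb : b - x ∈ K) (hc : c - x ∈ K)
    (hd : d - x ∈ K) (h : a * d = c * b) : a = c ∨ a = b := by
  set s := (a - x) + (d - x) - (c - x) - (b - x) with hs
  have hsK : s ∈ K := K.sub_mem (K.sub_mem (K.add_mem ha hd) hc) hb
  have hmul : s * x = (c - x) * (b - x) - (a - x) * (d - x) := by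
    linear_combination h + x * hs
  have hs0 : s = 0 := by
    by_contra hne
    refine hx ?_
    rw [← mul_div_cancel_left₀ x hne, hmul]
    exact K.div_mem (K.sub_mem (K.mul_mem hc hb) (K.mul_mem ha hd)) hsK
  have hprod : (a - c) * (a - b) = 0 := by
    linear_combination a * hs0 - a * hs - h
  rcases mul_eq_zero.1 hprod with h0 | h0
  · exact Or.inl (sub_eq_zero.1 h0)
  · exact Or.inr (sub_eq_zero.1 h0)

/-- **Bose–Chowla sets are Sidon modulo `q² − 1`.** Let `q` be a prime power, `F` a finite
field with `q²` elements, `K` a subfield of `F` with `q` elements, and `g` a generator of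
`Fˣ`. Then the pairwise differences of distinct elements of the Bose–Chowla set
`S = {i : 1 ≤ i ≤ q² − 2, gⁱ − g ∈ K}` are distinct modulo `q² − 1`. -/
theorem stmt_1 (q : ℕ) (hq : IsPrimePow q) (F : Type*) [Field F]
    (hF : Nat.card F = q ^ 2) (K : Subfield F) (hK : Nat.card K = q)
    (g : Fˣ) (hg : ∀ x : Fˣ, x ∈ Subgroup.zpowers g)
    (S : Set ℕ) (hS : S = {i : ℕ | 1 ≤ i ∧ i ≤ q ^ 2 - 2 ∧ (g : F) ^ i - (g : F) ∈ K}) :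
    ∀ i ∈ S, ∀ j ∈ S, ∀ k ∈ S, ∀ l ∈ S, i ≠ j → k ≠ l →
      ((i : ℤ) - (j : ℤ) ≡ (k : ℤ) - (l : ℤ) [ZMOD ((q : ℤ) ^ 2 - 1)]) →
      i = k ∧ j = l := by
  subst hS
  rintro i ⟨-, hi, hiK⟩ j ⟨-, hj, hjK⟩ k ⟨-, hk, hkK⟩ l ⟨-, hl, hlK⟩ hij - hmod
  have hq2 : 2 ≤ q := hq.two_le
  have hqq : 4 ≤ q ^ 2 := by nlinarith
  have hord : orderOf g = q ^ 2 - 1 := by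
    rw [orderOf_eq_card_of_forall_mem_zpowers hg, Nat.card_units, hF]
  have hgK : (g : F) ∉ K := by
    intro h
    have htop := K.eq_top_of_zpowers_generator_mem g hg h
    have hcard : Nat.card K = Nat.card F := by
      rw [htop]
      exact Nat.card_congr Subfield.topEquiv.toEquiv
    rw [hK, hF] at hcard
    nlinarith
  have hinj : ∀ m n : ℕ, m ≤ q ^ 2 - 2 → n ≤ q ^ 2 - 2 → (g : F) ^ m = (g : F) ^ n → m = n := by
    intro m n hm hn hmn
    refine pow_injOn_Iio_orderOf (x := g) ?_ ?_ (Units.ext (by simpa using hmn))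
    · rw [Set.mem_Iio, hord]; omega
    · rw [Set.mem_Iio, hord]; omega
  have hcast : ((orderOf g : ℕ) : ℤ) = (q : ℤ) ^ 2 - 1 := by
    rw [hord, Nat.cast_sub (by omega)]
    push_cast
    ring
  have hil : ((i + l : ℕ) : ℤ) ≡ ((k + j : ℕ) : ℤ) [ZMOD (orderOf g : ℤ)] := by
    rw [hcast]
    convert hmod.add_right ((j : ℤ) + l) using 1 <;> push_cast <;> ring
  have hpow : (g : F) ^ i * (g : F) ^ l = (g : F) ^ k * (g : F) ^ j := by
    rw [← pow_add, ← pow_add]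
    exact_mod_cast congrArg Units.val (pow_eq_pow_iff_modEq.2 (Int.natCast_modEq_iff.1 hil))
  rcases K.eq_or_eq_of_mul_eq_mul_of_sub_mem hgK hiK hjK hkK hlK hpow with h | h
  · refine ⟨hinj i k hi hk h, hinj j l hj hl ?_⟩
    rw [h] at hpow
    exact (mul_left_cancel₀ (pow_ne_zero _ g.ne_zero) hpow).symm
  · exact absurd (hinj i j hi hj h) hij
end

section
/- Let q be a power of a prime, let F be a finite field with q² elements, let K be a subfield of F with q elements, and let g be a generator of the multiplicative group Fˣ. Define S = {i ∈ ℕ : 1 ≤ i ≤ q² − 2 and g^i − g ∈ K}. Then the set of residues {(i − j) mod (q² − 1) : i, j ∈ S, i ≠ j} equals the set {n ∈ ℕ : 1 ≤ n ≤ q² − 2 and (q + 1) does not divide n}, and in particular it has exactly q(q − 1) elements. -/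
open Polynomial in
/-- A finite subfield with `q` elements consists of the roots of `X ^ q - X`. -/
theorem Subfield.mem_iff_pow_natCard_eq {F : Type*} [Field F] (K : Subfield F) [Finite K] (x : F) :
    x ∈ K ↔ x ^ Nat.card K = x := by
  classical
  have : Fintype K := Fintype.ofFinite K
  have hlt : 1 < Nat.card K := Finite.one_lt_card
  have hp := FiniteField.X_pow_card_sub_X_ne_zero F hlt
  have hroots : ((X ^ Nat.card K - X : F[X]).roots.toFinset : Set F)
      = {y | y ^ Nat.card K = y} := by
    ext y
    rw [Finset.mem_coe, Multiset.mem_toFinset, mem_roots hp]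
    simp [sub_eq_zero, -Nat.card_eq_fintype_card]
  have hsub : (K : Set F) ⊆ {y | y ^ Nat.card K = y} := by
    intro y hy
    have h := FiniteField.pow_card (⟨y, hy⟩ : K)
    rw [← Nat.card_eq_fintype_card] at h
    exact congrArg Subtype.val h
  have hcard : {y : F | y ^ Nat.card K = y}.ncard ≤ (K : Set F).ncard := by
    rw [← hroots, Set.ncard_coe_finset]
    calc _ ≤ _ := Multiset.toFinset_card_le _
      _ ≤ _ := card_roots' _
      _ = Nat.card K := FiniteField.X_pow_card_sub_X_natDegree_eq F hlt
      _ = _ := Nat.card_coe_set_eq _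
  have hfin : {y : F | y ^ Nat.card K = y}.Finite := hroots ▸ Finset.finite_toSet _
  exact Set.ext_iff.mp (Set.eq_of_subset_of_ncard_le hsub hcard hfin) x

/-- A power of a generator of `Fˣ`, with `F` of order `q ^ 2`, lies in the subfield of order `q`
if and only if the exponent is divisible by `q + 1`. -/
theorem Subfield.pow_mem_iff_dvd_of_orderOf {F : Type*} [Field F] (K : Subfield F) [Finite K]
    (g : Fˣ) (hg : orderOf g = Nat.card K ^ 2 - 1) (n : ℕ) :
    (g : F) ^ n ∈ K ↔ Nat.card K + 1 ∣ n := by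
  have hlt : 1 < Nat.card K := Finite.one_lt_card
  rw [K.mem_iff_pow_natCard_eq, ← pow_mul, ← Units.val_pow_eq_pow_val, ← Units.val_pow_eq_pow_val,
    Units.val_inj, pow_eq_pow_iff_modEq, hg]
  generalize Nat.card K = q at hlt
  obtain ⟨m, rfl⟩ : ∃ m, q = m + 1 := ⟨q - 1, by omega⟩
  have h1 : (m + 1) ^ 2 - 1 = m * (m + 1 + 1) := by
    rw [Nat.sub_eq_iff_eq_add (Nat.one_le_pow _ _ (by omega))]; ring
  rw [Nat.ModEq.comm, Nat.modEq_iff_dvd' (by nlinarith), h1,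
    show n * (m + 1) - n = m * n by rw [Nat.sub_eq_iff_eq_add (by nlinarith)]; ring]
  exact Nat.mul_dvd_mul_iff_left (by omega)

/-- If `F` has `|K| ^ 2` elements, every `h ∉ K` spans `F` together with `1` over `K`. -/
theorem Subfield.exists_add_mul_eq {F : Type*} [Field F] [Finite F] (K : Subfield F)
    (hF : Nat.card F = Nat.card K ^ 2) {h : F} (hh : h ∉ K) (x : F) :
    ∃ a ∈ K, ∃ b ∈ K, b + a * h = x := by
  have hinj : Function.Injective fun p : K × K => (p.2 : F) + p.1 * h := by
    rintro ⟨a, b⟩ ⟨c, d⟩ heq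
    replace heq : (b : F) + a * h = d + c * h := heq
    have hac : a = c := by
      by_contra hne
      have hne' : (a : F) - c ≠ 0 := sub_ne_zero.mpr fun e => hne (Subtype.ext e)
      have : h = (d - b) / (a - c) := by
        rw [eq_div_iff hne']; linear_combination heq
      exact hh (this ▸ K.div_mem (K.sub_mem d.2 b.2) (K.sub_mem a.2 c.2))
    subst hac
    simpa using heq
  have hbij := (Nat.bijective_iff_injective_and_card _).mpr
    ⟨hinj, by rw [Nat.card_prod, hF, sq]⟩
  obtain ⟨⟨a, b⟩, hab⟩ := hbij.2 x
  exact ⟨a, a.2, b, b.2, hab⟩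

/-- The number of `1 ≤ n ≤ q ^ 2 - 2` not divisible by `q + 1` is `q * (q - 1)`. -/
theorem Nat.ncard_not_add_one_dvd_le_sq_sub_two {q : ℕ} (hq : 1 < q) :
    {n : ℕ | 1 ≤ n ∧ n ≤ q ^ 2 - 2 ∧ ¬ (q + 1) ∣ n}.ncard = q * (q - 1) := by
  have hset : {n : ℕ | 1 ≤ n ∧ n ≤ q ^ 2 - 2 ∧ ¬ (q + 1) ∣ n}
      = ((Finset.Ioc 0 (q ^ 2 - 2)).filter fun n => ¬ (q + 1) ∣ n : Finset ℕ) := by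
    ext n
    simp [Nat.one_le_iff_ne_zero, Nat.pos_iff_ne_zero, and_assoc]
  have hsum := Finset.card_filter_add_card_filter_not (s := Finset.Ioc 0 (q ^ 2 - 2))
    (fun n => (q + 1) ∣ n)
  obtain ⟨m, rfl⟩ : ∃ m, q = m + 2 := ⟨q - 2, by omega⟩
  have h2 : (m + 2) ^ 2 - 2 = (m + 2) + (m + 2 + 1) * m := by
    rw [Nat.sub_eq_iff_eq_add (by nlinarith)]; ring
  have hdiv : ((m + 2) ^ 2 - 2) / (m + 2 + 1) = m := by
    rw [h2, Nat.add_mul_div_left _ _ (by omega), Nat.div_eq_of_lt (by omega), zero_add]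
  rw [Nat.Ioc_filter_dvd_card_eq_div, hdiv, Nat.card_Ioc, h2] at hsum
  rw [hset, Set.ncard_coe_finset, show m + 2 - 1 = m + 1 by omega, h2]
  rw [Nat.sub_zero] at hsum
  linarith


/-- **Difference set of the Bose–Chowla set.** Let `q` be a prime power, `F` a finite field
with `q²` elements, `K` a subfield of `F` with `q` elements, and `g` a generator of `Fˣ`,
and let `S = {i : 1 ≤ i ≤ q² − 2, gⁱ − g ∈ K}` be the Bose–Chowla set. Then the set of
residues `(i − j) mod (q² − 1)` over distinct `i, j ∈ S` equals the set of `n` with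
`1 ≤ n ≤ q² − 2` not divisible by `q + 1`, and in particular has exactly `q(q−1)` elements. -/
theorem stmt_2 (q : ℕ) (hq : IsPrimePow q) (F : Type*) [Field F]
    (hF : Nat.card F = q ^ 2) (K : Subfield F) (hK : Nat.card K = q)
    (g : Fˣ) (hg : ∀ x : Fˣ, x ∈ Subgroup.zpowers g)
    (S : Set ℕ) (hS : S = {i : ℕ | 1 ≤ i ∧ i ≤ q ^ 2 - 2 ∧ (g : F) ^ i - (g : F) ∈ K})
    (T : Set ℕ)
    (hT : T = {n : ℕ | ∃ i ∈ S, ∃ j ∈ S, i ≠ j ∧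
      (n : ℤ) = ((i : ℤ) - (j : ℤ)) % ((q : ℤ) ^ 2 - 1)}) :
    T = {n : ℕ | 1 ≤ n ∧ n ≤ q ^ 2 - 2 ∧ ¬ (q + 1) ∣ n} ∧ T.ncard = q * (q - 1) := by
  have hq1 : 1 < q := hq.one_lt
  have hq2 : q * 2 ≤ q ^ 2 := by nlinarith
  have : Finite F := Nat.finite_of_card_ne_zero (by rw [hF]; positivity)
  have hord : orderOf g = q ^ 2 - 1 := by
    rw [orderOf_eq_card_of_forall_mem_zpowers hg, Nat.card_units, hF]
  have hordZ : (orderOf g : ℤ) = (q : ℤ) ^ 2 - 1 := by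
    rw [hord, Nat.cast_sub (by omega)]; simp
  have hmem (n : ℕ) : (g : F) ^ n ∈ K ↔ q + 1 ∣ n := by
    rw [K.pow_mem_iff_dvd_of_orderOf g (by rw [hK, hord]), hK]
  have hgK : (g : F) ∉ K := by
    intro h
    have := Nat.le_of_dvd one_pos ((hmem 1).mp (by simpa using h))
    omega
  have hinj {i j : ℕ} (hi : i ≤ q ^ 2 - 2) (hj : j ≤ q ^ 2 - 2) (hij : (g : F) ^ i = (g : F) ^ j) :
      i = j := by
    refine pow_injOn_Iio_orderOf (x := g) ?_ ?_ (Units.ext (by simpa using hij)) <;>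
      simp only [Set.mem_Iio, hord] <;> omega
  have hres {n i j : ℕ} (hn : n ≤ q ^ 2 - 2) :
      (n : ℤ) = ((i : ℤ) - j) % ((q : ℤ) ^ 2 - 1) ↔ (g : F) ^ n * (g : F) ^ j = (g : F) ^ i := by
    have hn' : (n : ℤ) % ((q : ℤ) ^ 2 - 1) = n :=
      Int.emod_eq_of_lt (by omega) (by rw [← hordZ, hord]; omega)
    rw [← hn', ← hordZ, ← Int.ModEq, ← zpow_eq_zpow_iff_modEq, zpow_sub, eq_mul_inv_iff_mul_eq,
      Units.ext_iff]
    simp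
  have hex {a : F} (ha : a ∈ K) : ∃ i ∈ S, (g : F) ^ i = g + a := by
    have hne : (g : F) + a ≠ 0 := fun h => hgK (eq_neg_of_add_eq_zero_left h ▸ K.neg_mem ha)
    obtain ⟨k, hk⟩ := mem_powers_iff_mem_zpowers.mpr (hg (Units.mk0 _ hne))
    obtain ⟨i, hi, hgi⟩ : ∃ i < orderOf g, g ^ i = Units.mk0 _ hne :=
      ⟨k % orderOf g, Nat.mod_lt _ (orderOf_pos g), (pow_mod_orderOf g k).trans hk⟩
    have hgi' : (g : F) ^ i = g + a := by simpa using congrArg Units.val hgi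
    rw [hord] at hi
    refine ⟨i, ?_, hgi'⟩
    rw [hS]
    refine ⟨Nat.one_le_iff_ne_zero.mpr ?_, by omega, by simpa [hgi'] using ha⟩
    rintro rfl
    rw [pow_zero] at hgi'
    exact hgK (eq_sub_of_add_eq hgi'.symm ▸ K.sub_mem K.one_mem ha)
  have hTeq : T = {n : ℕ | 1 ≤ n ∧ n ≤ q ^ 2 - 2 ∧ ¬ (q + 1) ∣ n} := by
    rw [hT]
    ext n
    constructor
    · rintro ⟨i, hi, j, hj, hij, hn⟩
      rw [hS] at hi hj
      obtain ⟨-, hi2, hiK⟩ := hi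
      obtain ⟨-, hj2, hjK⟩ := hj
      have hnle : n ≤ q ^ 2 - 2 := by
        have := Int.emod_lt_of_pos ((i : ℤ) - j) (b := orderOf g) (by omega)
        rw [hordZ, ← hn, ← hordZ, hord] at this
        omega
      have hmul := (hres hnle).mp hn
      have hndvd : ¬ (q + 1) ∣ n := by
        intro hdvd
        have hnK := (hmem n).mpr hdvd
        have h1 : (g : F) ^ n = 1 := by
          by_contra hne
          have hne' : (g : F) ^ n - 1 ≠ 0 := sub_ne_zero.mpr hne
          have : (g : F) = (((g : F) ^ i - g) - (g : F) ^ n * ((g : F) ^ j - g))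
              / ((g : F) ^ n - 1) := by
            rw [eq_div_iff hne']; linear_combination hmul
          exact hgK (this ▸ K.div_mem (K.sub_mem hiK (K.mul_mem hnK hjK))
            (K.sub_mem hnK K.one_mem))
        rw [h1, one_mul] at hmul
        exact hij (hinj hi2 hj2 hmul.symm)
      exact ⟨Nat.one_le_iff_ne_zero.mpr fun h => hndvd (h ▸ dvd_zero _), hnle, hndvd⟩
    · rintro ⟨hn1, hnle, hndvd⟩
      obtain ⟨a, ha, b, hb, hab⟩ := K.exists_add_mul_eq (by rw [hF, hK])
        (fun h => hndvd ((hmem n).mp h)) ((g : F) ^ n * g - g)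
      obtain ⟨i, hi, hgi⟩ := hex hb
      obtain ⟨j, hj, hgj⟩ := hex (K.neg_mem ha)
      have hmul : (g : F) ^ n * (g : F) ^ j = (g : F) ^ i := by
        rw [hgi, hgj]; linear_combination -hab
      refine ⟨i, hi, j, hj, ?_, (hres hnle).mpr hmul⟩
      rintro rfl
      have h1 : (g : F) ^ n = (g : F) ^ 0 := by
        simpa using hmul
      have := hinj hnle (Nat.zero_le _) h1
      omega
  exact ⟨hTeq, hTeq ▸ Nat.ncard_not_add_one_dvd_le_sq_sub_two hq1⟩
end

section
/- The sequence a_M = (1/M²)·(sin(πM/(M²−1)) / sin(π/(M²−1)))², defined for M ≥ 2, tends to 1 as M → ∞. Consequently, the quantity 1 − a_M, which is an upper bound on the minimum subspace distance of the uniform linear array sensing subspace code with M sensors and N = M² − 1, tends to 0 as M → ∞. -/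
open Filter Topology in
/-- The Dirichlet-kernel quotient `sin (m * x) / (m * sin x)` tends to `1` when both `x` and
`m * x` tend to `0`. -/
theorem tendsto_sin_mul_div_mul_sin {ι : Type*} {l : Filter ι} {m x : ι → ℝ}
    (hm : ∀ᶠ i in l, m i ≠ 0) (hx : ∀ᶠ i in l, x i ≠ 0) (hx0 : Tendsto x l (𝓝 0))
    (hmx0 : Tendsto (fun i => m i * x i) l (𝓝 0)) :
    Tendsto (fun i => Real.sin (m i * x i) / (m i * Real.sin (x i))) l (𝓝 1) := by
  have hsinc {u : ι → ℝ} (hu : Tendsto u l (𝓝 0)) :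
      Tendsto (fun i => Real.sinc (u i)) l (𝓝 1) := by
    simpa [Function.comp_def] using (Real.continuous_sinc.tendsto 0).comp hu
  have h := (hsinc hmx0).div (hsinc hx0) one_ne_zero
  rw [div_one] at h
  refine h.congr' ?_
  filter_upwards [hm, hx] with i hmi hxi
  rw [Pi.div_apply, Real.sinc_of_ne_zero hxi, Real.sinc_of_ne_zero (mul_ne_zero hmi hxi)]
  field_simp

open Filter Topology in
theorem tendsto_natCast_mul_pi_div_sq_sub_one :
    Tendsto (fun M : ℕ => (M : ℝ) * (Real.pi / ((M : ℝ) ^ 2 - 1))) atTop (𝓝 0) := by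
  refine squeeze_zero' ?_ ?_ (tendsto_const_div_atTop_nhds_zero_nat (2 * Real.pi))
  all_goals
    filter_upwards [eventually_ge_atTop 2] with M hM
    have hM : (2 : ℝ) ≤ M := by exact_mod_cast hM
    have hN : 0 < (M : ℝ) ^ 2 - 1 := by nlinarith
  · positivity
  · rw [← mul_div_assoc, div_le_div_iff₀ hN (by positivity)]
    nlinarith [mul_nonneg Real.pi_pos.le (show (0 : ℝ) ≤ M ^ 2 - 2 by nlinarith)]

/-- The sequence `a_M = (1/M²)·(sin(πM/(M²−1)) / sin(π/(M²−1)))²` tends to `1` as `M → ∞`,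
and consequently `1 − a_M` (an upper bound on the minimum subspace distance of the ULA
sensing subspace code with `M` sensors and `N = M² − 1`) tends to `0`. -/
theorem stmt_10 :
    Filter.Tendsto (fun M : ℕ => (1 / (M : ℝ) ^ 2) *
        (Real.sin (Real.pi * M / ((M : ℝ) ^ 2 - 1)) /
          Real.sin (Real.pi / ((M : ℝ) ^ 2 - 1))) ^ 2)
      Filter.atTop (nhds 1) ∧
    Filter.Tendsto (fun M : ℕ => 1 - (1 / (M : ℝ) ^ 2) *
        (Real.sin (Real.pi * M / ((M : ℝ) ^ 2 - 1)) /
          Real.sin (Real.pi / ((M : ℝ) ^ 2 - 1))) ^ 2)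
      Filter.atTop (nhds 0) := by
  have hN : ∀ᶠ M : ℕ in Filter.atTop, 1 ≤ (M : ℝ) ∧ 0 < (M : ℝ) ^ 2 - 1 := by
    filter_upwards [Filter.eventually_ge_atTop 2] with M hM
    have hM : (2 : ℝ) ≤ M := by exact_mod_cast hM
    constructor <;> nlinarith
  have hx0 : Filter.Tendsto (fun M : ℕ => Real.pi / ((M : ℝ) ^ 2 - 1)) Filter.atTop (nhds 0) := by
    refine squeeze_zero' ?_ ?_ tendsto_natCast_mul_pi_div_sq_sub_one
    · exact hN.mono fun M hM => div_nonneg Real.pi_pos.le hM.2.le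
    · exact hN.mono fun M hM => le_mul_of_one_le_left (div_nonneg Real.pi_pos.le hM.2.le) hM.1
  have h := (tendsto_sin_mul_div_mul_sin
    (hN.mono fun M hM => (zero_lt_one.trans_le hM.1).ne')
    (hN.mono fun M hM => (div_pos Real.pi_pos hM.2).ne')
    hx0 tendsto_natCast_mul_pi_div_sq_sub_one).pow 2
  rw [one_pow] at h
  have key : Filter.Tendsto (fun M : ℕ => (1 / (M : ℝ) ^ 2) *
        (Real.sin (Real.pi * M / ((M : ℝ) ^ 2 - 1)) /
          Real.sin (Real.pi / ((M : ℝ) ^ 2 - 1))) ^ 2)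
      Filter.atTop (nhds 1) := by
    refine h.congr fun M => ?_
    rw [show Real.pi * M / ((M : ℝ) ^ 2 - 1) = M * (Real.pi / ((M : ℝ) ^ 2 - 1)) by ring,
      div_pow, div_pow, mul_pow, div_mul_div_comm, one_mul]
  exact ⟨key, by simpa only [sub_self] using key.const_sub 1⟩
end

section
/- Let M ≥ 2 and N = M² − 1, and let A = {d_1, …, d_M} ⊆ {0, 1, …, N − 1} be a set of M natural numbers that is Sidon modulo N (pairwise differences of distinct elements are distinct modulo N). Then for any two distinct N-th roots of unity α ≠ α', the vectors c(α) = (α^{d_1}, …, α^{d_M}) and c(α') = (α'^{d_1}, …, α'^{d_M}) in ℂ^M are linearly independent over ℂ; in particular, the sensing subspace code {span c(α) : α^N = 1} consists of N distinct one-dimensional subspaces. -/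
/-- If all elements of an `M`-element Sidon set modulo `N = M ^ 2 - 1` are congruent modulo a
divisor `r` of `N`, then `r = 1`. -/
theorem eq_one_of_dvd_sub_of_sidon {M N : ℕ} (hM : 2 ≤ M) (hN : N = M ^ 2 - 1) {d : Fin M → ℕ}
    (hinj : Function.Injective d)
    (hSidon : ∀ i j k l : Fin M, i ≠ j → k ≠ l →
      ((d i : ℤ) - (d j : ℤ) ≡ (d k : ℤ) - (d l : ℤ) [ZMOD (N : ℤ)]) →
      d i = d k ∧ d j = d l)
    {r : ℕ} (hrN : r ∣ N) (hr : ∀ i j, (r : ℤ) ∣ (d i : ℤ) - d j) : r = 1 := by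
  have hsq : 4 ≤ M ^ 2 := by nlinarith
  have hNpos : 0 < N := by omega
  obtain ⟨q, hq⟩ := hrN
  have hr0 : 0 < r := Nat.pos_of_ne_zero (by rintro rfl; simp at hq; omega)
  by_contra hr1
  have hcard : (Finset.univ.offDiag : Finset (Fin M × Fin M)).card ≤ (Finset.range q).card := by
    have hmod : ∀ i j, ∃ c : ℕ, c < q ∧ ((d i : ℤ) - d j) % N = r * c := by
      intro i j
      obtain ⟨c, hc⟩ : (r : ℤ) ∣ ((d i : ℤ) - d j) % N := by
        rw [Int.emod_def]
        exact dvd_sub (hr i j) ((Int.natCast_dvd_natCast.2 ⟨q, hq⟩).mul_right _)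
      have h0 := Int.emod_nonneg ((d i : ℤ) - d j) (b := (N : ℤ)) (by omega)
      have h1 := Int.emod_lt_of_pos ((d i : ℤ) - d j) (b := (N : ℤ)) (by omega)
      have hrz : (0 : ℤ) < r := by exact_mod_cast hr0
      rw [hc] at h0 h1
      lift c to ℕ using nonneg_of_mul_nonneg_right h0 hrz
      refine ⟨c, ?_, hc⟩
      rw [hq] at h1
      exact Nat.lt_of_mul_lt_mul_left (a := r) (by exact_mod_cast h1)
    choose f hf hfmod using hmod
    refine Finset.card_le_card_of_injOn (fun p => f p.1 p.2) ?_ ?_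
    · intro p _
      simpa using hf p.1 p.2
    · rintro ⟨i, j⟩ hij ⟨k, l⟩ hkl h
      simp only [Finset.coe_offDiag, Set.mem_offDiag, Finset.coe_univ, Set.mem_univ,
        true_and] at hij hkl h
      have hmod : (d i : ℤ) - d j ≡ d k - d l [ZMOD N] := by
        rw [Int.ModEq, hfmod, hfmod, h]
      obtain ⟨h1, h2⟩ := hSidon i j k l hij hkl hmod
      rw [hinj h1, hinj h2]
  rw [Finset.offDiag_card, Finset.card_range, Finset.card_univ, Fintype.card_fin] at hcard
  have h2 : 2 * q ≤ r * q := Nat.mul_le_mul_right q (by omega)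
  have h3 : M * M ≤ q + M := by omega
  have h4 : 2 * q + 1 ≤ M ^ 2 := by omega
  nlinarith

/-- **No subspace erasures for Sidon sensing codes.** For `M ≥ 2`, `N = M² − 1`, and sensor
positions `d_1, …, d_M ∈ {0, …, N − 1}` forming a set that is Sidon modulo `N`, the codeword
vectors `c(α) = (α^{d_1}, …, α^{d_M})` and `c(α')` associated with distinct `N`-th roots of
unity `α ≠ α'` are linearly independent over `ℂ`; in particular the sensing subspace code
`{span c(α) : α^N = 1}` consists of `N` distinct one-dimensional subspaces. -/
theorem stmt_15 (M N : ℕ) (hM : 2 ≤ M) (hN : N = M ^ 2 - 1)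
    (d : Fin M → ℕ) (hinj : Function.Injective d) (hrange : ∀ m, d m < N)
    (hSidon : ∀ i j k l : Fin M, i ≠ j → k ≠ l →
      ((d i : ℤ) - (d j : ℤ) ≡ (d k : ℤ) - (d l : ℤ) [ZMOD (N : ℤ)]) →
      d i = d k ∧ d j = d l) :
    (∀ α α' : ℂ, α ^ N = 1 → α' ^ N = 1 → α ≠ α' →
      LinearIndependent ℂ ![(fun m => α ^ d m : Fin M → ℂ), (fun m => α' ^ d m : Fin M → ℂ)]) ∧
    Set.ncard {S : Submodule ℂ (Fin M → ℂ) | ∃ α : ℂ, α ^ N = 1 ∧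
      S = Submodule.span ℂ {(fun m => α ^ d m : Fin M → ℂ)}} = N := by
  have hsq : 4 ≤ M ^ 2 := by nlinarith
  have hN0 : N ≠ 0 := by omega
  have hne : ∀ α : ℂ, α ^ N = 1 → α ≠ 0 := by
    rintro α h rfl
    simp [hN0] at h
  have hind : ∀ α α' : ℂ, α ^ N = 1 → α' ^ N = 1 → α ≠ α' →
      LinearIndependent ℂ
        ![(fun m => α ^ d m : Fin M → ℂ), (fun m => α' ^ d m : Fin M → ℂ)] := by
    intro α α' hα hα' hαα'
    have h0 := hne α hα
    have h0' := hne α' hα'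
    rw [LinearIndependent.pair_iff]
    intro s t hst
    have hst' : ∀ m, s * α ^ d m + t * α' ^ d m = 0 := fun m => by
      simpa using congrFun hst m
    by_cases hs : s = 0
    · refine ⟨hs, ?_⟩
      simpa [hs, h0'] using hst' ⟨0, by omega⟩
    exfalso
    have hβ0 : α / α' ≠ 0 := div_ne_zero h0 h0'
    have hβ : ∀ m, (α / α') ^ d m = -t / s := fun m => by
      have h0d : α' ^ d m ≠ 0 := pow_ne_zero _ h0'
      rw [div_pow, div_eq_div_iff h0d hs]
      linear_combination hst' m
    have hone : orderOf (α / α') = 1 := by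
      refine eq_one_of_dvd_sub_of_sidon hM hN hinj hSidon ?_ fun i j => ?_
      · exact orderOf_dvd_of_pow_eq_one (by rw [div_pow, hα, hα', div_one])
      · have h := hβ i
        rw [← hβ j] at h
        rw [← Units.val_mk0 hβ0, orderOf_units, orderOf_dvd_iff_zpow_eq_one]
        ext
        simp [zpow_sub₀ hβ0, h, h0, h0']
    rw [orderOf_eq_one_iff, div_eq_one_iff_eq h0'] at hone
    exact hαα' hone
  refine ⟨hind, ?_⟩
  have himage : {S : Submodule ℂ (Fin M → ℂ) | ∃ α : ℂ, α ^ N = 1 ∧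
      S = Submodule.span ℂ {(fun m => α ^ d m : Fin M → ℂ)}} =
      (fun α : ℂ => Submodule.span ℂ {(fun m => α ^ d m : Fin M → ℂ)}) ''
        (Polynomial.nthRootsFinset N (1 : ℂ) : Set ℂ) := by
    ext S
    simp [Polynomial.mem_nthRootsFinset (Nat.pos_of_ne_zero hN0), eq_comm]
  rw [himage, Set.InjOn.ncard_image, Set.ncard_coe_finset,
    (Complex.isPrimitiveRoot_exp N hN0).card_nthRootsFinset]
  intro α hα α' hα' h
  rw [Finset.mem_coe, Polynomial.mem_nthRootsFinset (Nat.pos_of_ne_zero hN0)] at hα hα'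
  by_contra hαα'
  have hmem : (fun m => α ^ d m : Fin M → ℂ) ∈
      Submodule.span ℂ {(fun m => α' ^ d m : Fin M → ℂ)} :=
    h.le (Submodule.mem_span_singleton_self _)
  obtain ⟨a, ha⟩ := Submodule.mem_span_singleton.1 hmem
  exact one_ne_zero
    (LinearIndependent.pair_iff.1 (hind α α' hα hα' hαα') 1 (-a) (by rw [← ha]; simp)).1
end
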